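/- An orean form has at most one exact decomposition: if (κ_s, κ_e) and (κ_s', κ_e') are exact decompositions of the same orean form F, then κ_s = κ_s' and κ_e = κ_e'. Moreover, an exact decomposition of F is a left decomposition if and only if (F_c, F_n) is a left exact pair. -/

import Mathlib

open CategoryTheory

universe w v u

/-- A form over a category `C`, presented as a cluster system:
clusters per object and relations `B ≥_f A` (written `Rel f A B`),
satisfying (F1)-(F3). -/
structure Form (C : Type u) [Category.{v} C] where
  Cl : C → Type w
  Rel : ∀ {X Y : C}, (X ⟶ Y) → Cl X → Cl Y → Prop
  rel_id : ∀ {X : C} (A : Cl X), Rel (𝟙 X) A A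
  rel_comp : ∀ {X Y Z : C} {f : X ⟶ Y} {g : Y ⟶ Z} {A : Cl X} {B : Cl Y} {D : Cl Z},
      Rel f A B → Rel g B D → Rel (f ≫ g) A D
  rel_antisymm : ∀ {X : C} {A B : Cl X}, Rel (𝟙 X) A B → Rel (𝟙 X) B A → A = B

namespace Form

variable {C : Type u} [Category.{v} C]

/-- The fibre order on clusters. -/
def le (F : Form C) {X : C} (A B : F.Cl X) : Prop := F.Rel (𝟙 X) A B

/-- `S` is the image of `f`, i.e. the direct image of the top cluster of the
domain of `f` along `f`. -/
def IsImageOf (F : Form C) {W X : C} (S : F.Cl X) (f : W ⟶ X) : Prop :=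
  ∃ t : F.Cl W, (∀ A : F.Cl W, F.le A t) ∧ F.Rel f t S ∧ ∀ T : F.Cl X, F.Rel f t T → F.le S T

/-- `S` is the kernel of `g`, i.e. the inverse image of the bottom cluster of the
codomain of `g` along `g`. -/
def IsKernelOf (F : Form C) {X Y : C} (S : F.Cl X) (g : X ⟶ Y) : Prop :=
  ∃ b : F.Cl Y, (∀ A : F.Cl Y, F.le b A) ∧ F.Rel g S b ∧ ∀ T : F.Cl X, F.Rel g T b → F.le T S

/-- A cluster is conormal when it is an image of some morphism. -/
def ConormalCl (F : Form C) {X : C} (S : F.Cl X) : Prop :=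
  ∃ (W : C) (f : W ⟶ X), F.IsImageOf S f

/-- A cluster is normal when it is a kernel of some morphism. -/
def NormalCl (F : Form C) {X : C} (S : F.Cl X) : Prop :=
  ∃ (Y : C) (g : X ⟶ Y), F.IsKernelOf S g

/-- A form is conormal when every cluster is conormal. -/
def IsConormal (F : Form C) : Prop := ∀ (X : C) (S : F.Cl X), F.ConormalCl S

/-- A form is normal when every cluster is normal. -/
def IsNormal (F : Form C) : Prop := ∀ (X : C) (S : F.Cl X), F.NormalCl S

def IsJoinOf (F : Form C) {X : C} (A B J : F.Cl X) : Prop :=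
  F.le A J ∧ F.le B J ∧ ∀ D : F.Cl X, F.le A D → F.le B D → F.le J D

def IsMeetOf (F : Form C) {X : C} (A B M : F.Cl X) : Prop :=
  F.le M A ∧ F.le M B ∧ ∀ D : F.Cl X, F.le D A → F.le D B → F.le D M

/-- `T` is the direct image of `S` along `f`. -/
def IsDimgOf (F : Form C) {X Y : C} (f : X ⟶ Y) (S : F.Cl X) (T : F.Cl Y) : Prop :=
  F.Rel f S T ∧ ∀ T' : F.Cl Y, F.Rel f S T' → F.le T T'

/-- `S` is the inverse image of `T` along `f`. -/
def IsIimgOf (F : Form C) {X Y : C} (f : X ⟶ Y) (T : F.Cl Y) (S : F.Cl X) : Prop :=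
  F.Rel f S T ∧ ∀ S' : F.Cl X, F.Rel f S' T → F.le S' S

/-- Orean form: (O1) fibres are bounded lattices, (O3) direct and inverse images exist,
(O2) relations along composites decompose. -/
def IsOrean (F : Form C) : Prop :=
  (∀ X : C, ∃ b : F.Cl X, ∀ A, F.le b A) ∧
  (∀ X : C, ∃ t : F.Cl X, ∀ A, F.le A t) ∧
  (∀ (X : C) (A B : F.Cl X), ∃ J, F.IsJoinOf A B J) ∧
  (∀ (X : C) (A B : F.Cl X), ∃ M, F.IsMeetOf A B M) ∧
  (∀ {X Y : C} (f : X ⟶ Y) (S : F.Cl X), ∃ T, F.IsDimgOf f S T) ∧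
  (∀ {X Y : C} (f : X ⟶ Y) (T : F.Cl Y), ∃ S, F.IsIimgOf f T S) ∧
  (∀ {X Y Z : C} (f : X ⟶ Y) (g : Y ⟶ Z) (A : F.Cl X) (D : F.Cl Z),
      F.Rel (f ≫ g) A D → ∃ B : F.Cl Y, F.Rel f A B ∧ F.Rel g B D)

/-- `m` is an embedding of the (conormal) cluster `S`. -/
def IsEmbeddingOf (F : Form C) {W X : C} (m : W ⟶ X) (S : F.Cl X) : Prop :=
  F.IsImageOf S m ∧ ∀ {W' : C} (f' : W' ⟶ X) (S' : F.Cl X),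
    F.IsImageOf S' f' → F.le S' S → ∃! g : W' ⟶ W, g ≫ m = f'

/-- `e` is a quotient of the (normal) cluster `K`. -/
def IsQuotientOf (F : Form C) {X Y : C} (e : X ⟶ Y) (K : F.Cl X) : Prop :=
  F.IsKernelOf K e ∧ ∀ {Y' : C} (g' : X ⟶ Y') (K' : F.Cl X),
    F.IsKernelOf K' g' → F.le K K' → ∃! h : Y ⟶ Y', e ≫ h = g'

/-- The axiom (N1) for a general form, stated via characterizing predicates. -/
def N1 (F : Form C) : Prop :=
  (∀ {X Y : C} (f : X ⟶ Y) (S V : F.Cl X) (T : F.Cl Y) (K J : F.Cl X),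
      F.IsDimgOf f S T → F.IsIimgOf f T V → F.IsKernelOf K f → F.IsJoinOf S K J → V = J) ∧
  (∀ {X Y : C} (f : X ⟶ Y) (T : F.Cl Y) (S : F.Cl X) (U I M : F.Cl Y),
      F.IsIimgOf f T S → F.IsDimgOf f S U → F.IsImageOf I f → F.IsMeetOf T I M → U = M)

/-- The axiom (N2) for a general form. -/
def N2 (F : Form C) : Prop :=
  ∀ {X Y : C} (f : X ⟶ Y), ∃ (I : C) (e : X ⟶ I) (m : I ⟶ Y) (K : F.Cl X) (S : F.Cl Y),
    F.IsKernelOf K f ∧ F.IsQuotientOf e K ∧ F.IsImageOf S f ∧ F.IsEmbeddingOf m S ∧ e ≫ m = f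

/-- The axiom (N3) for a general form. -/
def N3 (F : Form C) : Prop :=
  (∀ {X : C} (S T J : F.Cl X), F.NormalCl S → F.NormalCl T → F.IsJoinOf S T J → F.NormalCl J) ∧
  (∀ {X : C} (S T M : F.Cl X), F.ConormalCl S → F.ConormalCl T → F.IsMeetOf S T M → F.ConormalCl M)

/-- The subform of `F` given by a selection of clusters. -/
def Subform (F : Form C) (P : ∀ X : C, F.Cl X → Prop) : Form C where
  Cl X := {A : F.Cl X // P X A}
  Rel f A B := F.Rel f A.1 B.1
  rel_id A := F.rel_id A.1
  rel_comp h h' := F.rel_comp h h'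
  rel_antisymm h h' := Subtype.ext (F.rel_antisymm h h')

/-- The product of two forms over the same category. -/
def prod (F G : Form C) : Form C where
  Cl X := F.Cl X × G.Cl X
  Rel f A B := F.Rel f A.1 B.1 ∧ G.Rel f A.2 B.2
  rel_id A := ⟨F.rel_id A.1, G.rel_id A.2⟩
  rel_comp h h' := ⟨F.rel_comp h.1 h'.1, G.rel_comp h.2 h'.2⟩
  rel_antisymm h h' := Prod.ext (F.rel_antisymm h.1 h'.1) (G.rel_antisymm h.2 h'.2)

/-- Isomorphism of forms over the same category. -/
def IsIsomorphic (F G : Form C) : Prop :=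
  ∃ e : ∀ X : C, F.Cl X ≃ G.Cl X,
    ∀ {X Y : C} (f : X ⟶ Y) (A : F.Cl X) (B : F.Cl Y),
      F.Rel f A B ↔ G.Rel f (e X A) (e Y B)

/-- An orean factorization (stated for general forms): a conormal orean form together
with a normal orean form such that every morphism factors as a quotient of its kernel
followed by an embedding of its image. -/
def IsOreanFactorization (Fs Fe : Form C) : Prop :=
  Fs.IsOrean ∧ Fs.IsConormal ∧ Fe.IsOrean ∧ Fe.IsNormal ∧
  ∀ {X Y : C} (f : X ⟶ Y), ∃ (I : C) (e : X ⟶ I) (m : I ⟶ Y) (K : Fe.Cl X) (S : Fs.Cl Y),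
    Fe.IsKernelOf K f ∧ Fe.IsQuotientOf e K ∧ Fs.IsImageOf S f ∧ Fs.IsEmbeddingOf m S ∧
    e ≫ m = f

end Form

/-- An operator between two forms over the same category. -/
structure Operator {C : Type u} [Category.{v} C] (F G : Form C) where
  app : ∀ {X : C}, F.Cl X → G.Cl X
  mono : ∀ {X Y : C} {f : X ⟶ Y} {A : F.Cl X} {B : F.Cl Y},
      F.Rel f A B → G.Rel f (app A) (app B)

namespace Operator

variable {C : Type u} [Category.{v} C] {F G : Form C}

/-- A full operator. -/
def Full (τ : Operator F G) : Prop :=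
  ∀ {X Y : C} {f : X ⟶ Y} {A : F.Cl X} {B : F.Cl Y},
    G.Rel f (τ.app A) (τ.app B) → F.Rel f A B

/-- A conormal operator: it maps images of morphisms to images. -/
def Conormal (τ : Operator F G) : Prop :=
  ∀ {W X : C} (f : W ⟶ X) (S : F.Cl X), F.IsImageOf S f → G.IsImageOf (τ.app S) f

/-- A normal operator: it maps kernels of morphisms to kernels. -/
def Normal (τ : Operator F G) : Prop :=
  ∀ {X Y : C} (g : X ⟶ Y) (S : F.Cl X), F.IsKernelOf S g → G.IsKernelOf (τ.app S) g

end Operator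

/-- The identity operator. -/
def Form.idOp {C : Type u} [Category.{v} C] (F : Form C) : Operator F F :=
  ⟨fun A => A, fun h => h⟩

/-- The inclusion of a subform. -/
def Form.subformIncl {C : Type u} [Category.{v} C] (F : Form C) (P : ∀ X : C, F.Cl X → Prop) :
    Operator (F.Subform P) F where
  app A := A.1
  mono h := h

/-- The subform of clusters fixed by an operator `κ : F → F`. -/
def Form.fixedSubform {C : Type u} [Category.{v} C] (F : Form C) (κ : Operator F F) : Form C :=
  F.Subform (fun _ A => κ.app A = A)

/-- A semiexact pair of forms. -/
def IsSemiexactPair {C : Type u} [Category.{v} C] (Fs Fe : Form C) : Prop :=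
  Fs.IsOrean ∧ Fs.IsConormal ∧ Fe.IsOrean ∧ Fe.IsNormal ∧
  (∃ α : Operator Fs Fe, α.Conormal) ∧ (∃ β : Operator Fe Fs, β.Normal)

/-- A left exact pair of forms: a semiexact pair where the conormal operator is a
left inverse of the normal operator. -/
def IsLeftExactPair {C : Type u} [Category.{v} C] (Fs Fe : Form C) : Prop :=
  Fs.IsOrean ∧ Fs.IsConormal ∧ Fe.IsOrean ∧ Fe.IsNormal ∧
  ∃ (α : Operator Fs Fe) (β : Operator Fe Fs), α.Conormal ∧ β.Normal ∧
    ∀ {X : C} (R : Fe.Cl X), α.app (β.app R) = R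

/-- An orean form, with the (uniquely determined) bounded-lattice and
direct/inverse image structure bundled. -/
structure OreanForm (C : Type u) [Category.{v} C] extends Form C where
  bot : ∀ X : C, Cl X
  top : ∀ X : C, Cl X
  join : ∀ {X : C}, Cl X → Cl X → Cl X
  meet : ∀ {X : C}, Cl X → Cl X → Cl X
  dimg : ∀ {X Y : C}, (X ⟶ Y) → Cl X → Cl Y
  iimg : ∀ {X Y : C}, (X ⟶ Y) → Cl Y → Cl X
  bot_le : ∀ {X : C} (A : Cl X), Rel (𝟙 X) (bot X) A
  le_top : ∀ {X : C} (A : Cl X), Rel (𝟙 X) A (top X)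
  le_join_left : ∀ {X : C} (A B : Cl X), Rel (𝟙 X) A (join A B)
  le_join_right : ∀ {X : C} (A B : Cl X), Rel (𝟙 X) B (join A B)
  join_le : ∀ {X : C} {A B D : Cl X}, Rel (𝟙 X) A D → Rel (𝟙 X) B D → Rel (𝟙 X) (join A B) D
  meet_le_left : ∀ {X : C} (A B : Cl X), Rel (𝟙 X) (meet A B) A
  meet_le_right : ∀ {X : C} (A B : Cl X), Rel (𝟙 X) (meet A B) B
  le_meet : ∀ {X : C} {A B D : Cl X}, Rel (𝟙 X) D A → Rel (𝟙 X) D B → Rel (𝟙 X) D (meet A B)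
  rel_dimg : ∀ {X Y : C} (f : X ⟶ Y) (S : Cl X), Rel f S (dimg f S)
  dimg_le : ∀ {X Y : C} {f : X ⟶ Y} {S : Cl X} {T : Cl Y}, Rel f S T → Rel (𝟙 Y) (dimg f S) T
  iimg_rel : ∀ {X Y : C} (f : X ⟶ Y) (T : Cl Y), Rel f (iimg f T) T
  le_iimg : ∀ {X Y : C} {f : X ⟶ Y} {S : Cl X} {T : Cl Y}, Rel f S T → Rel (𝟙 X) S (iimg f T)
  rel_decomp : ∀ {X Y Z : C} {f : X ⟶ Y} {g : Y ⟶ Z} {A : Cl X} {D : Cl Z},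
      Rel (f ≫ g) A D → ∃ B : Cl Y, Rel f A B ∧ Rel g B D

namespace OreanForm

variable {C : Type u} [Category.{v} C]

def le (F : OreanForm C) {X : C} (A B : F.Cl X) : Prop := F.Rel (𝟙 X) A B

/-- The image of a morphism: direct image of the top cluster. -/
def Im (F : OreanForm C) {W X : C} (f : W ⟶ X) : F.Cl X := F.dimg f (F.top W)

/-- The kernel of a morphism: inverse image of the bottom cluster. -/
def Ker (F : OreanForm C) {X Y : C} (g : X ⟶ Y) : F.Cl X := F.iimg g (F.bot Y)

def Conormal (F : OreanForm C) {X : C} (S : F.Cl X) : Prop :=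
  ∃ (W : C) (f : W ⟶ X), F.Im f = S

def Normal (F : OreanForm C) {X : C} (S : F.Cl X) : Prop :=
  ∃ (Y : C) (g : X ⟶ Y), F.Ker g = S

def IsConormalForm (F : OreanForm C) : Prop := ∀ {X : C} (S : F.Cl X), F.Conormal S

def IsNormalForm (F : OreanForm C) : Prop := ∀ {X : C} (S : F.Cl X), F.Normal S

def IsBinormalForm (F : OreanForm C) : Prop := F.IsConormalForm ∧ F.IsNormalForm

/-- `m` is an embedding of the cluster `S`. -/
def IsEmbedding (F : OreanForm C) {W X : C} (m : W ⟶ X) (S : F.Cl X) : Prop :=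
  F.Im m = S ∧ ∀ {W' : C} (f' : W' ⟶ X), F.le (F.Im f') S → ∃! g : W' ⟶ W, g ≫ m = f'

/-- `e` is a quotient of the cluster `K`. -/
def IsQuotient (F : OreanForm C) {X Y : C} (e : X ⟶ Y) (K : F.Cl X) : Prop :=
  F.Ker e = K ∧ ∀ {Y' : C} (g' : X ⟶ Y'), F.le K (F.Ker g') → ∃! h : Y ⟶ Y', e ≫ h = g'

/-- The axiom (N1) at a given morphism. -/
def N1At (F : OreanForm C) {X Y : C} (f : X ⟶ Y) : Prop :=
  (∀ S : F.Cl X, F.iimg f (F.dimg f S) = F.join S (F.Ker f)) ∧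
  (∀ T : F.Cl Y, F.dimg f (F.iimg f T) = F.meet T (F.Im f))

def N1 (F : OreanForm C) : Prop := ∀ {X Y : C} (f : X ⟶ Y), F.N1At f

def N2 (F : OreanForm C) : Prop :=
  ∀ {X Y : C} (f : X ⟶ Y), ∃ (I : C) (e : X ⟶ I) (m : I ⟶ Y),
    F.IsQuotient e (F.Ker f) ∧ F.IsEmbedding m (F.Im f) ∧ e ≫ m = f

def N3 (F : OreanForm C) : Prop :=
  (∀ {X : C} (S T : F.Cl X), F.Normal S → F.Normal T → F.Normal (F.join S T)) ∧
  (∀ {X : C} (S T : F.Cl X), F.Conormal S → F.Conormal T → F.Conormal (F.meet S T))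

def IsNoetherian (F : OreanForm C) : Prop := F.N1 ∧ F.N2 ∧ F.N3

/-- The conormal hull: the subform of conormal clusters. -/
def conormalHull (F : OreanForm C) : Form C := F.toForm.Subform (fun _ S => F.Conormal S)

/-- The normal hull: the subform of normal clusters. -/
def normalHull (F : OreanForm C) : Form C := F.toForm.Subform (fun _ S => F.Normal S)

def conormalIncl (F : OreanForm C) : Operator F.conormalHull F.toForm :=
  F.toForm.subformIncl _

def normalIncl (F : OreanForm C) : Operator F.normalHull F.toForm :=
  F.toForm.subformIncl _

/-- A strongly orean form: the conormal and normal hulls are both orean. -/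
def StronglyOrean (F : OreanForm C) : Prop :=
  F.conormalHull.IsOrean ∧ F.normalHull.IsOrean

/-- `T` is the conormal interior of `S` (largest conormal cluster below `S`). -/
def IsConormalInterior (F : OreanForm C) {X : C} (S T : F.Cl X) : Prop :=
  F.Conormal T ∧ F.le T S ∧ ∀ T' : F.Cl X, F.Conormal T' → F.le T' S → F.le T' T

/-- `T` is the conormal exterior of `S` (smallest conormal cluster above `S`). -/
def IsConormalExterior (F : OreanForm C) {X : C} (S T : F.Cl X) : Prop :=
  F.Conormal T ∧ F.le S T ∧ ∀ T' : F.Cl X, F.Conormal T' → F.le S T' → F.le T T'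

/-- `T` is the normal interior of `S` (largest normal cluster below `S`). -/
def IsNormalInterior (F : OreanForm C) {X : C} (S T : F.Cl X) : Prop :=
  F.Normal T ∧ F.le T S ∧ ∀ T' : F.Cl X, F.Normal T' → F.le T' S → F.le T' T

/-- `T` is the normal exterior of `S` (smallest normal cluster above `S`). -/
def IsNormalExterior (F : OreanForm C) {X : C} (S T : F.Cl X) : Prop :=
  F.Normal T ∧ F.le S T ∧ ∀ T' : F.Cl X, F.Normal T' → F.le S T' → F.le T T'

/-- Componentwise product of orean forms. -/
def prod (F G : OreanForm C) : OreanForm C where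
  toForm := F.toForm.prod G.toForm
  bot X := (F.bot X, G.bot X)
  top X := (F.top X, G.top X)
  join A B := (F.join A.1 B.1, G.join A.2 B.2)
  meet A B := (F.meet A.1 B.1, G.meet A.2 B.2)
  dimg f S := (F.dimg f S.1, G.dimg f S.2)
  iimg f T := (F.iimg f T.1, G.iimg f T.2)
  bot_le A := ⟨F.bot_le A.1, G.bot_le A.2⟩
  le_top A := ⟨F.le_top A.1, G.le_top A.2⟩
  le_join_left A B := ⟨F.le_join_left A.1 B.1, G.le_join_left A.2 B.2⟩
  le_join_right A B := ⟨F.le_join_right A.1 B.1, G.le_join_right A.2 B.2⟩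
  join_le h h' := ⟨F.join_le h.1 h'.1, G.join_le h.2 h'.2⟩
  meet_le_left A B := ⟨F.meet_le_left A.1 B.1, G.meet_le_left A.2 B.2⟩
  meet_le_right A B := ⟨F.meet_le_right A.1 B.1, G.meet_le_right A.2 B.2⟩
  le_meet h h' := ⟨F.le_meet h.1 h'.1, G.le_meet h.2 h'.2⟩
  rel_dimg f S := ⟨F.rel_dimg f S.1, G.rel_dimg f S.2⟩
  dimg_le h := ⟨F.dimg_le h.1, G.dimg_le h.2⟩
  iimg_rel f T := ⟨F.iimg_rel f T.1, G.iimg_rel f T.2⟩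
  le_iimg h := ⟨F.le_iimg h.1, G.le_iimg h.2⟩
  rel_decomp h := by
    obtain ⟨B1, h1, h1'⟩ := F.rel_decomp h.1
    obtain ⟨B2, h2, h2'⟩ := G.rel_decomp h.2
    exact ⟨(B1, B2), ⟨h1, h2⟩, ⟨h1', h2'⟩⟩

end OreanForm

/-- An orean factorization, stated for orean forms. -/
def OreanFactorization {C : Type u} [Category.{v} C] (Fs Fe : OreanForm C) : Prop :=
  Fs.IsConormalForm ∧ Fe.IsNormalForm ∧
  ∀ {X Y : C} (f : X ⟶ Y), ∃ (I : C) (e : X ⟶ I) (m : I ⟶ Y),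
    Fe.IsQuotient e (Fe.Ker f) ∧ Fs.IsEmbedding m (Fs.Im f) ∧ e ≫ m = f

/-- A conormal operator between orean forms (preserves images). -/
def OpConormal {C : Type u} [Category.{v} C] {Fs Fe : OreanForm C}
    (α : Operator Fs.toForm Fe.toForm) : Prop :=
  ∀ {W X : C} (f : W ⟶ X), α.app (Fs.Im f) = Fe.Im f

/-- A normal operator between orean forms (preserves kernels). -/
def OpNormal {C : Type u} [Category.{v} C] {Fs Fe : OreanForm C}
    (β : Operator Fs.toForm Fe.toForm) : Prop :=
  ∀ {X Y : C} (g : X ⟶ Y), β.app (Fs.Ker g) = Fe.Ker g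

/-- `W` is the Wyler join `A ∗ R = (π_R ·ˢ A) ·ˢ π_R` relative to an orean
factorization `(Fs, Fe)`. -/
def WylerJoin {C : Type u} [Category.{v} C] (Fs Fe : OreanForm C) {X : C}
    (A : Fs.Cl X) (R : Fe.Cl X) (W : Fs.Cl X) : Prop :=
  ∃ (Q : C) (p : X ⟶ Q), Fe.IsQuotient p R ∧ Fs.iimg p (Fs.dimg p A) = W

section Decomp

variable {C : Type u} [Category.{v} C]

/-- Core of a decomposition: a pair of idempotent operators whose subforms of fixed
clusters are a conormal orean form resp. a normal orean form. -/
def IsDecompCore (F : OreanForm C) (κs κe : Operator F.toForm F.toForm) : Prop :=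
  (∀ {X : C} (A : F.Cl X), κs.app (κs.app A) = κs.app A) ∧
  (∀ {X : C} (A : F.Cl X), κe.app (κe.app A) = κe.app A) ∧
  (F.toForm.fixedSubform κs).IsOrean ∧ (F.toForm.fixedSubform κs).IsConormal ∧
  (F.toForm.fixedSubform κe).IsOrean ∧ (F.toForm.fixedSubform κe).IsNormal

def JoinEq (F : OreanForm C) (κs κe : Operator F.toForm F.toForm) : Prop :=
  ∀ {X : C} (S : F.Cl X), S = F.join (κs.app S) (κe.app S)

def MeetEq (F : OreanForm C) (κs κe : Operator F.toForm F.toForm) : Prop :=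
  ∀ {X : C} (S : F.Cl X), S = F.meet (κs.app S) (κe.app S)

def LeftEq (F : OreanForm C) (κs : Operator F.toForm F.toForm) : Prop :=
  ∀ {X : C} (S : F.Cl X), S = κs.app S

def RightEq (F : OreanForm C) (κe : Operator F.toForm F.toForm) : Prop :=
  ∀ {X : C} (S : F.Cl X), S = κe.app S

def TopEq (F : OreanForm C) : Prop := ∀ {X : C} (S : F.Cl X), S = F.top X

def BotEq (F : OreanForm C) : Prop := ∀ {X : C} (S : F.Cl X), S = F.bot X

/-- A decomposition of an orean form: the decomposing term is one of the six
binary bounded-lattice terms. -/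
def IsDecomp (F : OreanForm C) (κs κe : Operator F.toForm F.toForm) : Prop :=
  IsDecompCore F κs κe ∧
  (JoinEq F κs κe ∨ MeetEq F κs κe ∨ LeftEq F κs ∨ RightEq F κe ∨ TopEq F ∨ BotEq F)

def IsJoinDecomp (F : OreanForm C) (κs κe : Operator F.toForm F.toForm) : Prop :=
  IsDecompCore F κs κe ∧ JoinEq F κs κe

def IsMeetDecomp (F : OreanForm C) (κs κe : Operator F.toForm F.toForm) : Prop :=
  IsDecompCore F κs κe ∧ MeetEq F κs κe

def IsLeftDecomp (F : OreanForm C) (κs κe : Operator F.toForm F.toForm) : Prop :=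
  IsDecompCore F κs κe ∧ LeftEq F κs

def IsRightDecomp (F : OreanForm C) (κs κe : Operator F.toForm F.toForm) : Prop :=
  IsDecompCore F κs κe ∧ RightEq F κe

/-- A semiexact decomposition: the decomposition projections are binormal and the pair
of fixed subforms is a semiexact pair. -/
def IsSemiexact (F : OreanForm C) (κs κe : Operator F.toForm F.toForm) : Prop :=
  (∃ τs : Operator F.toForm (F.toForm.fixedSubform κs),
      (∀ {X : C} (A : F.Cl X), (τs.app A).1 = κs.app A) ∧ τs.Conormal ∧ τs.Normal) ∧
  (∃ τe : Operator F.toForm (F.toForm.fixedSubform κe),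
      (∀ {X : C} (A : F.Cl X), (τe.app A).1 = κe.app A) ∧ τe.Conormal ∧ τe.Normal) ∧
  IsSemiexactPair (F.toForm.fixedSubform κs) (F.toForm.fixedSubform κe)

/-- An exact decomposition: semiexact, and the subform inclusions are
conormal resp. normal. -/
def IsExact (F : OreanForm C) (κs κe : Operator F.toForm F.toForm) : Prop :=
  IsSemiexact F κs κe ∧
  (F.toForm.subformIncl (fun _ A => κs.app A = A)).Conormal ∧
  (F.toForm.subformIncl (fun _ A => κe.app A = A)).Normal

end Decomp


section Helpers

variable {C : Type u} [Category.{v} C]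

theorem Form.le_refl' (F : Form C) {X : C} (A : F.Cl X) : F.le A A := F.rel_id A

theorem Form.le_trans' (F : Form C) {X : C} {A B D : F.Cl X} (h : F.le A B) (h' : F.le B D) :
    F.le A D := by
  have := F.rel_comp h h'
  rwa [Category.comp_id] at this

theorem Form.IsImageOf.unique {F : Form C} {W X : C} {S T : F.Cl X} {f : W ⟶ X}
    (h : F.IsImageOf S f) (h' : F.IsImageOf T f) : S = T := by
  obtain ⟨t, ht, h1, h2⟩ := h
  obtain ⟨t', ht', h1', h2'⟩ := h'
  have e : t = t' := F.rel_antisymm (ht' t) (ht t')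
  subst e
  exact F.rel_antisymm (h2 _ h1') (h2' _ h1)

theorem Form.IsKernelOf.unique {F : Form C} {X Y : C} {S T : F.Cl X} {f : X ⟶ Y}
    (h : F.IsKernelOf S f) (h' : F.IsKernelOf T f) : S = T := by
  obtain ⟨t, ht, h1, h2⟩ := h
  obtain ⟨t', ht', h1', h2'⟩ := h'
  have e : t = t' := F.rel_antisymm (ht t') (ht' t)
  subst e
  exact F.rel_antisymm (h2' _ h1) (h2 _ h1')

theorem OreanForm.isImageOf_Im (F : OreanForm C) {W X : C} (f : W ⟶ X) :
    F.toForm.IsImageOf (F.Im f) f :=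
  ⟨F.top W, fun A => F.le_top A, F.rel_dimg f _, fun _ h => F.dimg_le h⟩

theorem OreanForm.isKernelOf_Ker (F : OreanForm C) {W X : C} (f : W ⟶ X) :
    F.toForm.IsKernelOf (F.Ker f) f :=
  ⟨F.bot X, fun A => F.bot_le A, F.iimg_rel f _, fun _ h => F.le_iimg h⟩

/-- `κ` corestricts to a binormal operator to the subform given by `P`. -/
def BinormalCorestr (F : OreanForm C) (P : ∀ X : C, F.Cl X → Prop)
    (κ : Operator F.toForm F.toForm) : Prop :=
  ∃ τ : Operator F.toForm (F.toForm.Subform P),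
      (∀ {X : C} (A : F.Cl X), (τ.app A).1 = κ.app A) ∧ τ.Conormal ∧ τ.Normal

theorem fixed_s {F : OreanForm C} {κs κe : Operator F.toForm F.toForm}
    (hd : IsDecomp F κs κe) (hx : IsExact F κs κe) :
    (fun X (A : F.Cl X) => κs.app A = A) = (fun _ A => F.Conormal A) := by
  funext X A
  apply propext
  constructor
  · intro h
    obtain ⟨W, f, hf⟩ := hd.1.2.2.2.1 X ⟨A, h⟩
    exact ⟨W, f, (F.isImageOf_Im f).unique (hx.2.1 f _ hf)⟩
  · rintro ⟨W, f, rfl⟩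
    obtain ⟨⟨τ, h1, h2, -⟩, -⟩ := hx.1
    have h3 := hx.2.1 f _ (h2 f _ (F.isImageOf_Im f))
    have h4 := h3.unique (F.isImageOf_Im f)
    exact (h1 _).symm.trans h4

theorem fixed_e {F : OreanForm C} {κs κe : Operator F.toForm F.toForm}
    (hd : IsDecomp F κs κe) (hx : IsExact F κs κe) :
    (fun X (A : F.Cl X) => κe.app A = A) = (fun _ A => F.Normal A) := by
  funext X A
  apply propext
  constructor
  · intro h
    obtain ⟨W, f, hf⟩ := hd.1.2.2.2.2.2 X ⟨A, h⟩
    exact ⟨W, f, (F.isKernelOf_Ker f).unique (hx.2.2 f _ hf)⟩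
  · rintro ⟨W, f, rfl⟩
    obtain ⟨-, ⟨τ, h1, -, h2⟩, -⟩ := hx.1
    have h3 := hx.2.2 f _ (h2 f _ (F.isKernelOf_Ker f))
    have h4 := h3.unique (F.isKernelOf_Ker f)
    exact (h1 _).symm.trans h4

/-- Everything that is used about an exact decomposition. -/
structure ExactData (F : OreanForm C) (κs κe : Operator F.toForm F.toForm) : Prop where
  s_iff : ∀ {X : C} (A : F.Cl X), κs.app A = A ↔ F.Conormal A
  e_iff : ∀ {X : C} (A : F.Cl X), κe.app A = A ↔ F.Normal A
  s_idem : ∀ {X : C} (A : F.Cl X), κs.app (κs.app A) = κs.app A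
  e_idem : ∀ {X : C} (A : F.Cl X), κe.app (κe.app A) = κe.app A
  s_bin : BinormalCorestr F (fun _ A => F.Conormal A) κs
  e_bin : BinormalCorestr F (fun _ A => F.Normal A) κe
  pair : IsSemiexactPair F.conormalHull F.normalHull
  n_incl : F.normalIncl.Normal
  term : JoinEq F κs κe ∨ MeetEq F κs κe ∨ LeftEq F κs ∨ RightEq F κe ∨
    ∀ {X : C} (A B : F.Cl X), A = B

theorem ExactData.mk' {F : OreanForm C} {κs κe : Operator F.toForm F.toForm}
    (hd : IsDecomp F κs κe) (hx : IsExact F κs κe) : ExactData F κs κe := by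
  have es := fixed_s hd hx
  have ee := fixed_e hd hx
  refine ⟨fun A => iff_of_eq (congrFun (congrFun es _) A),
    fun A => iff_of_eq (congrFun (congrFun ee _) A), hd.1.1, hd.1.2.1, ?_, ?_, ?_, ?_, ?_⟩
  · have h : BinormalCorestr F (fun X (A : F.Cl X) => κs.app A = A) κs := hx.1.1
    rwa [es] at h
  · have h : BinormalCorestr F (fun X (A : F.Cl X) => κe.app A = A) κe := hx.1.2.1
    rwa [ee] at h
  · have h : IsSemiexactPair (F.toForm.Subform (fun X (A : F.Cl X) => κs.app A = A))
      (F.toForm.Subform (fun X (A : F.Cl X) => κe.app A = A)) := hx.1.2.2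
    rwa [es, ee] at h
  · have h : (F.toForm.subformIncl (fun X (A : F.Cl X) => κe.app A = A)).Normal := hx.2.2
    rwa [ee] at h
  · rcases hd.2 with h | h | h | h | h | h
    · exact Or.inl h
    · exact Or.inr (Or.inl h)
    · exact Or.inr (Or.inr (Or.inl h))
    · exact Or.inr (Or.inr (Or.inr (Or.inl h)))
    · exact Or.inr (Or.inr (Or.inr (Or.inr fun A B => (h A).trans (h B).symm)))
    · exact Or.inr (Or.inr (Or.inr (Or.inr fun A B => (h A).trans (h B).symm)))

theorem bin_agree_normal {F : OreanForm C} {P : ∀ X : C, F.Cl X → Prop}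
    {κ κ' : Operator F.toForm F.toForm}
    (h : BinormalCorestr F P κ) (h' : BinormalCorestr F P κ') {X : C} {R : F.Cl X}
    (hR : F.Normal R) : κ.app R = κ'.app R := by
  obtain ⟨Y, g, rfl⟩ := hR
  obtain ⟨τ, h1, -, h2⟩ := h
  obtain ⟨τ', h1', -, h2'⟩ := h'
  rw [← h1, ← h1', (h2 g _ (F.isKernelOf_Ker g)).unique (h2' g _ (F.isKernelOf_Ker g))]

theorem bin_agree_conormal {F : OreanForm C} {P : ∀ X : C, F.Cl X → Prop}
    {κ κ' : Operator F.toForm F.toForm}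
    (h : BinormalCorestr F P κ) (h' : BinormalCorestr F P κ') {X : C} {R : F.Cl X}
    (hR : F.Conormal R) : κ.app R = κ'.app R := by
  obtain ⟨Y, g, rfl⟩ := hR
  obtain ⟨τ, h1, h2, -⟩ := h
  obtain ⟨τ', h1', h2', -⟩ := h'
  rw [← h1, ← h1', (h2 g _ (F.isImageOf_Im g)).unique (h2' g _ (F.isImageOf_Im g))]

/-- Two idempotent operators with the same fixed clusters, both interior. -/
theorem agree_interior {F : OreanForm C} {κ κ' : Operator F.toForm F.toForm}
    (i : ∀ {X : C} (A : F.Cl X), κ'.app (κ.app A) = κ.app A)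
    (i' : ∀ {X : C} (A : F.Cl X), κ.app (κ'.app A) = κ'.app A)
    (l : ∀ {X : C} (A : F.Cl X), F.toForm.le (κ.app A) A)
    (l' : ∀ {X : C} (A : F.Cl X), F.toForm.le (κ'.app A) A) {X : C} (A : F.Cl X) :
    κ.app A = κ'.app A := by
  apply F.rel_antisymm
  · have := κ'.mono (l A)
    rwa [i] at this
  · have := κ.mono (l' A)
    rwa [i'] at this

theorem agree_exterior {F : OreanForm C} {κ κ' : Operator F.toForm F.toForm}
    (i : ∀ {X : C} (A : F.Cl X), κ'.app (κ.app A) = κ.app A)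
    (i' : ∀ {X : C} (A : F.Cl X), κ.app (κ'.app A) = κ'.app A)
    (l : ∀ {X : C} (A : F.Cl X), F.toForm.le A (κ.app A))
    (l' : ∀ {X : C} (A : F.Cl X), F.toForm.le A (κ'.app A)) {X : C} (A : F.Cl X) :
    κ.app A = κ'.app A := by
  apply F.rel_antisymm
  · have := κ.mono (l' A)
    rwa [i'] at this
  · have := κ'.mono (l A)
    rwa [i] at this

theorem join_s {F : OreanForm C} {κs κe : Operator F.toForm F.toForm} (h : JoinEq F κs κe)
    {X : C} (A : F.Cl X) : F.toForm.le (κs.app A) A := by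
  have := F.le_join_left (κs.app A) (κe.app A)
  rwa [← h A] at this

theorem join_e {F : OreanForm C} {κs κe : Operator F.toForm F.toForm} (h : JoinEq F κs κe)
    {X : C} (A : F.Cl X) : F.toForm.le (κe.app A) A := by
  have := F.le_join_right (κs.app A) (κe.app A)
  rwa [← h A] at this

theorem meet_s {F : OreanForm C} {κs κe : Operator F.toForm F.toForm} (h : MeetEq F κs κe)
    {X : C} (A : F.Cl X) : F.toForm.le A (κs.app A) := by
  have := F.meet_le_left (κs.app A) (κe.app A)
  rwa [← h A] at this

theorem meet_e {F : OreanForm C} {κs κe : Operator F.toForm F.toForm} (h : MeetEq F κs κe)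
    {X : C} (A : F.Cl X) : F.toForm.le A (κe.app A) := by
  have := F.meet_le_right (κs.app A) (κe.app A)
  rwa [← h A] at this

/-- If normal clusters are conormal, an exact join or meet decomposition is left. -/
theorem left_of_normal_conormal {F : OreanForm C} {κs κe : Operator F.toForm F.toForm}
    (d : ExactData F κs κe)
    (hn : ∀ {X : C} (R : F.Cl X), F.Normal R → κs.app R = R) : LeftEq F κs := by
  intro X S
  rcases d.term with h | h | h | h | h
  · apply F.rel_antisymm _ (join_s h S)
    have h1 := κs.mono (join_e h S)
    rw [hn _ ((d.e_iff _).1 (d.e_idem S))] at h1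
    have h2 := F.join_le (F.rel_id (κs.app S)) h1
    rwa [← h S] at h2
  · apply F.rel_antisymm (meet_s h S)
    have h1 := κs.mono (meet_e h S)
    rw [hn _ ((d.e_iff _).1 (d.e_idem S))] at h1
    have h2 := F.le_meet (F.rel_id (κs.app S)) h1
    rwa [← h S] at h2
  · exact h S
  · exact (hn _ ((d.e_iff _).1 (h S).symm)).symm
  · exact h _ _

theorem agree_of_left {F : OreanForm C} {κs κe κs' κe' : Operator F.toForm F.toForm}
    (d : ExactData F κs κe) (d' : ExactData F κs' κe') (h : LeftEq F κs)
    {X : C} (S : F.Cl X) : κs.app S = κs'.app S ∧ κe.app S = κe'.app S := by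
  have hc := (d.s_iff _).1 (h S).symm
  exact ⟨bin_agree_conormal d.s_bin d'.s_bin hc, bin_agree_conormal d.e_bin d'.e_bin hc⟩

theorem agree_of_right {F : OreanForm C} {κs κe κs' κe' : Operator F.toForm F.toForm}
    (d : ExactData F κs κe) (d' : ExactData F κs' κe') (h : RightEq F κe)
    {X : C} (S : F.Cl X) : κs.app S = κs'.app S ∧ κe.app S = κe'.app S := by
  have hc := (d.e_iff _).1 (h S).symm
  exact ⟨bin_agree_normal d.s_bin d'.s_bin hc, bin_agree_normal d.e_bin d'.e_bin hc⟩

theorem agree_join_meet {F : OreanForm C} {κs κe κs' κe' : Operator F.toForm F.toForm}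
    (d : ExactData F κs κe) (d' : ExactData F κs' κe') (h : JoinEq F κs κe)
    (h' : MeetEq F κs' κe')
    {X : C} (S : F.Cl X) : κs.app S = κs'.app S ∧ κe.app S = κe'.app S := by
  refine agree_of_left d d' (left_of_normal_conormal d fun R hR => ?_) S
  apply F.rel_antisymm (join_s h R)
  rw [bin_agree_normal d.s_bin d'.s_bin hR]
  exact meet_s h' R

theorem agree_all {F : OreanForm C} {κs κe κs' κe' : Operator F.toForm F.toForm}
    (d : ExactData F κs κe) (d' : ExactData F κs' κe')
    {X : C} (S : F.Cl X) : κs.app S = κs'.app S ∧ κe.app S = κe'.app S := by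
  have i1 : ∀ {X : C} (A : F.Cl X), κs'.app (κs.app A) = κs.app A :=
    fun A => (d'.s_iff _).2 ((d.s_iff _).1 (d.s_idem A))
  have i2 : ∀ {X : C} (A : F.Cl X), κs.app (κs'.app A) = κs'.app A :=
    fun A => (d.s_iff _).2 ((d'.s_iff _).1 (d'.s_idem A))
  have j1 : ∀ {X : C} (A : F.Cl X), κe'.app (κe.app A) = κe.app A :=
    fun A => (d'.e_iff _).2 ((d.e_iff _).1 (d.e_idem A))
  have j2 : ∀ {X : C} (A : F.Cl X), κe.app (κe'.app A) = κe'.app A :=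
    fun A => (d.e_iff _).2 ((d'.e_iff _).1 (d'.e_idem A))
  have sw : ∀ {X : C} {S : F.Cl X}, (κs'.app S = κs.app S ∧ κe'.app S = κe.app S) →
    (κs.app S = κs'.app S ∧ κe.app S = κe'.app S) := fun p => ⟨p.1.symm, p.2.symm⟩
  rcases d.term with h | h | h | h | h
  case inr.inr.inl => exact agree_of_left d d' h S
  case inr.inr.inr.inl => exact agree_of_right d d' h S
  case inr.inr.inr.inr => exact ⟨h _ _, h _ _⟩
  all_goals rcases d'.term with h' | h' | h' | h' | h'
  case inl.inr.inr.inl => exact sw (agree_of_left d' d h' S)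
  case inl.inr.inr.inr.inl => exact sw (agree_of_right d' d h' S)
  case inl.inr.inr.inr.inr => exact ⟨h' _ _, h' _ _⟩
  case inr.inl.inr.inr.inl => exact sw (agree_of_left d' d h' S)
  case inr.inl.inr.inr.inr.inl => exact sw (agree_of_right d' d h' S)
  case inr.inl.inr.inr.inr.inr => exact ⟨h' _ _, h' _ _⟩
  case inl.inr.inl => exact agree_join_meet d d' h h' S
  case inr.inl.inl => exact sw (agree_join_meet d' d h' h S)
  case inl.inl =>
    exact ⟨agree_interior i1 i2 (join_s h) (join_s h') S,
      agree_interior j1 j2 (join_e h) (join_e h') S⟩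
  case inr.inl.inr.inl =>
    exact ⟨agree_exterior i1 i2 (meet_s h) (meet_s h') S,
      agree_exterior j1 j2 (meet_e h) (meet_e h') S⟩

theorem leftExact_of_left {F : OreanForm C} {κs κe : Operator F.toForm F.toForm}
    (d : ExactData F κs κe) (h : LeftEq F κs) :
    IsLeftExactPair F.conormalHull F.normalHull := by
  obtain ⟨p1, p2, p3, p4, ⟨α, hα⟩, ⟨β, hβ⟩⟩ := d.pair
  refine ⟨p1, p2, p3, p4, α, β, hα, hβ, ?_⟩
  intro X R
  obtain ⟨τs, s1, s2, s3⟩ := d.s_bin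
  obtain ⟨τe, e1, e2, e3⟩ := d.e_bin
  have hb : (β.app R).1 = R.1 := by
    obtain ⟨Y, g, hg⟩ := p4 X R
    have k1 := hβ g R hg
    have k2 := s3 g _ (d.n_incl g R hg)
    rw [k1.unique k2]
    exact (s1 _).trans (h _).symm
  have ha : (α.app (β.app R)).1 = κe.app (β.app R).1 := by
    obtain ⟨W, f, hf⟩ := (β.app R).2
    have k2 := s2 f _ (F.isImageOf_Im f)
    have k3 : τs.app (F.Im f) = β.app R :=
      Subtype.ext ((s1 _).trans ((h _).symm.trans hf))
    rw [k3] at k2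
    have k4 := (hα f _ k2).unique (e2 f _ (F.isImageOf_Im f))
    rw [k4, ← hf]
    exact e1 _
  apply Subtype.ext
  rw [ha, hb]
  exact (d.e_iff _).2 R.2

theorem left_of_leftExact {F : OreanForm C} {κs κe : Operator F.toForm F.toForm}
    (d : ExactData F κs κe) (h : IsLeftExactPair F.conormalHull F.normalHull) :
    LeftEq F κs := by
  obtain ⟨p1, p2, p3, p4, α, β, hα, hβ, hαβ⟩ := h
  obtain ⟨τs, s1, s2, s3⟩ := d.s_bin
  obtain ⟨τe, e1, e2, e3⟩ := d.e_bin
  have key : ∀ {X : C} (R : F.Cl X), F.Normal R → κe.app (κs.app R) = R := by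
    intro X R hR
    have hb : (β.app ⟨R, hR⟩).1 = κs.app R := by
      obtain ⟨Y, g, hg⟩ := p4 X ⟨R, hR⟩
      have k1 := hβ g _ hg
      have k2 := s3 g _ (d.n_incl g _ hg)
      rw [k1.unique k2]
      exact s1 _
    have ha : (α.app (β.app ⟨R, hR⟩)).1 = κe.app (β.app ⟨R, hR⟩).1 := by
      obtain ⟨W, f, hf⟩ := (β.app ⟨R, hR⟩).2
      have k2 := s2 f _ (F.isImageOf_Im f)
      have k3 : τs.app (F.Im f) = β.app ⟨R, hR⟩ :=
        Subtype.ext ((s1 _).trans (((d.s_iff _).2 ⟨W, f, rfl⟩).trans hf))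
      rw [k3] at k2
      have k4 := (hα f _ k2).unique (e2 f _ (F.isImageOf_Im f))
      rw [k4, ← hf]
      exact e1 _
    have hc : (α.app (β.app ⟨R, hR⟩)).1 = R := congrArg Subtype.val (hαβ ⟨R, hR⟩)
    exact (congrArg κe.app hb).symm.trans (ha.symm.trans hc)
  apply left_of_normal_conormal d
  intro X R hR
  have hk := key R hR
  rcases d.term with h | h | h | h | h
  · apply F.rel_antisymm (join_s h R)
    have := join_e h (κs.app R)
    rwa [hk] at this
  · refine F.rel_antisymm ?_ (meet_s h R)
    have := meet_e h (κs.app R)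
    rwa [hk] at this
  · exact (h R).symm
  · exact (h (κs.app R)).trans hk
  · exact h _ _

end Helpers

/-- Theorem: an orean form has at most one exact decomposition, and an exact
decomposition is a left decomposition iff `(F_c, F_n)` is a left exact pair. -/
theorem exact_decomposition_unique {C : Type u} [Category.{v} C] (F : OreanForm C) :
    (∀ κs κe κs' κe' : Operator F.toForm F.toForm,
      IsDecomp F κs κe → IsExact F κs κe → IsDecomp F κs' κe' → IsExact F κs' κe' →
      ∀ {X : C} (S : F.Cl X), κs.app S = κs'.app S ∧ κe.app S = κe'.app S) ∧
    (∀ κs κe : Operator F.toForm F.toForm, IsDecomp F κs κe → IsExact F κs κe →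
      (IsLeftDecomp F κs κe ↔ IsLeftExactPair F.conormalHull F.normalHull)) := by
  refine ⟨fun κs κe κs' κe' hd hx hd' hx' X S =>
    agree_all (ExactData.mk' hd hx) (ExactData.mk' hd' hx') S, fun κs κe hd hx => ?_⟩
  exact ⟨fun h => leftExact_of_left (ExactData.mk' hd hx) h.2,
    fun h => ⟨hd.1, left_of_leftExact (ExactData.mk' hd hx) h⟩⟩
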